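/- Let X be a compact metric space, f : X → X a continuous map with the s-limit shadowing property, C a chain component of f, D ∈ 𝒟(C), and 𝒢 a full Furstenberg family. Then for any n ≥ 2, the set B = ⋂_{ε>0} {(x_1,…,x_n) ∈ [V^s(D)]^n : T_f(x_1,…,x_n;ε) ∈ 𝒢} is a dense subset of [V^s(D)]^n. -/

import Mathlib

open Filter Metric Set Topology

section Defs

variable {X : Type*} [MetricSpace X]

/-- A δ-chain of `f` of length `k` (with `k ≥ 1`) within the set `C`, from `x` to `y`. -/
def ChainIn (f : X → X) (C : Set X) (δ : ℝ) (k : ℕ) (x y : X) : Prop :=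
  1 ≤ k ∧ ∃ c : ℕ → X, c 0 = x ∧ c k = y ∧ (∀ i ≤ k, c i ∈ C) ∧
    ∀ i < k, dist (f (c i)) (c (i + 1)) ≤ δ

/-- `x → y` : for every `δ > 0` there is a `δ`-chain of `f` from `x` to `y`. -/
def ChainReach (f : X → X) (x y : X) : Prop :=
  ∀ δ > 0, ∃ k, ChainIn f Set.univ δ k x y

/-- `x` is chain recurrent for `f`. -/
def ChainRecurrent (f : X → X) (x : X) : Prop := ChainReach f x x

/-- `C` is a chain component of `f`: an equivalence class of the relation `↔`
on the set of chain recurrent points. -/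
def IsChainComponent (f : X → X) (C : Set X) : Prop :=
  ∃ x, ChainRecurrent f x ∧
    C = {y | ChainRecurrent f y ∧ ChainReach f x y ∧ ChainReach f y x}

/-- The set of lengths of δ-cycles of `f` restricted to `C`. -/
def cycleLengths (f : X → X) (C : Set X) (δ : ℝ) : Set ℕ :=
  {k | ∃ x ∈ C, ChainIn f C δ k x x}

/-- The greatest common divisor of a set of natural numbers
(the greatest natural number dividing every element). -/
noncomputable def setGcd (S : Set ℕ) : ℕ := sSup {d | ∀ k ∈ S, d ∣ k}

/-- `x ∼_{C,δ} y` : there is a δ-chain of `f|_C` from `x` to `y` whose length is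
divisible by `m(C,δ)`, the gcd of the lengths of all δ-cycles of `f|_C`. -/
def SimCd (f : X → X) (C : Set X) (δ : ℝ) (x y : X) : Prop :=
  ∃ k, setGcd (cycleLengths f C δ) ∣ k ∧ ChainIn f C δ k x y

/-- `x ∼_C y` : `x ∼_{C,δ} y` for all `δ > 0`. -/
def SimC (f : X → X) (C : Set X) (x y : X) : Prop :=
  ∀ δ > 0, SimCd f C δ x y

/-- `𝒟(C,δ)` : the set of equivalence classes of `∼_{C,δ}`. -/
def DClassesd (f : X → X) (C : Set X) (δ : ℝ) : Set (Set X) :=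
  {D | ∃ x ∈ C, D = {y ∈ C | SimCd f C δ x y}}

/-- `𝒟(C)` : the set of equivalence classes of `∼_C`. -/
def DClasses (f : X → X) (C : Set X) : Set (Set X) :=
  {D | ∃ x ∈ C, D = {y ∈ C | SimC f C x y}}

/-- `W^s(C) = {x : lim_{i→∞} d(f^i(x), C) = 0}`. -/
def wStable (f : X → X) (C : Set X) : Set X :=
  {x | Tendsto (fun i => infDist (f^[i] x) C) atTop (nhds 0)}

/-- `V^s(D) = ⋂_{δ>0} {x ∈ W^s(C) : lim_{i→∞} d(f^i(x), f^i(D_δ)) = 0}`, where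
`D_δ` is the unique element of `𝒟(C,δ)` containing `D`. -/
def vStable (f : X → X) (C D : Set X) : Set X :=
  {x | x ∈ wStable f C ∧ ∀ δ > 0, ∀ Dd ∈ DClassesd f C δ, D ⊆ Dd →
    Tendsto (fun i => infDist (f^[i] x) (f^[i] '' Dd)) atTop (nhds 0)}

/-- The s-limit shadowing property. -/
def SLimitShadowing (f : X → X) : Prop :=
  ∀ ε > 0, ∃ δ > 0, ∀ x : ℕ → X,
    (∀ i, dist (f (x i)) (x (i + 1)) ≤ δ) →
    Tendsto (fun i => dist (f (x i)) (x (i + 1))) atTop (nhds 0) →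
    ∃ z : X, (∀ i, dist (f^[i] z) (x i) ≤ ε) ∧
      Tendsto (fun i => dist (f^[i] z) (x i)) atTop (nhds 0)

/-- The limit shadowing property. -/
def LimitShadowing (f : X → X) : Prop :=
  ∀ x : ℕ → X, Tendsto (fun i => dist (f (x i)) (x (i + 1))) atTop (nhds 0) →
    ∃ z : X, Tendsto (fun i => dist (f^[i] z) (x i)) atTop (nhds 0)

/-- The (plain) shadowing property. -/
def ShadowingProperty (f : X → X) : Prop :=
  ∀ ε > 0, ∃ δ > 0, ∀ x : ℕ → X, (∀ i, dist (f (x i)) (x (i + 1)) ≤ δ) →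
    ∃ z : X, ∀ i, dist (f^[i] z) (x i) ≤ ε

/-- A Furstenberg family: hereditary upward and proper. -/
def FurstenbergFamily (F : Set (Set ℕ)) : Prop :=
  (∀ A B : Set ℕ, A ∈ F → A ⊆ B → B ∈ F) ∧ F.Nonempty ∧ F ≠ Set.univ

/-- A full Furstenberg family. -/
def FullFamily (F : Set (Set ℕ)) : Prop :=
  ∀ A ∈ F, ∀ n : ℕ, {i ∈ A | n ≤ i} ∈ F

/-- A translation invariant Furstenberg family. -/
def TranslationInvariantFamily (F : Set (Set ℕ)) : Prop :=
  ∀ A ∈ F, ∀ n : ℕ, ((fun i => i + n) '' A ∈ F ∧ {i | i + n ∈ A} ∈ F)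

/-- `S_f(x₁,…,xₙ; r) = {i : min_{j<k} d(fⁱ(x_j), fⁱ(x_k)) > r}`. -/
def Sset (f : X → X) {n : ℕ} (x : Fin n → X) (r : ℝ) : Set ℕ :=
  {i | ∀ j k : Fin n, j < k → r < dist (f^[i] (x j)) (f^[i] (x k))}

/-- `T_f(x₁,…,xₙ; r) = {i : max_{j<k} d(fⁱ(x_j), fⁱ(x_k)) < r}`. -/
def Tset (f : X → X) {n : ℕ} (x : Fin n → X) (r : ℝ) : Set ℕ :=
  {i | ∀ j k : Fin n, j < k → dist (f^[i] (x j)) (f^[i] (x k)) < r}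

/-- `(x₁,…,xₙ)` is an `(ℱ,𝒢)`-δ-scrambled n-tuple for `f`. -/
def Scrambled (f : X → X) (F G : Set (Set ℕ)) (δ : ℝ) {n : ℕ} (x : Fin n → X) : Prop :=
  Sset f x δ ∈ F ∧ ∀ ε > 0, Tset f x ε ∈ G

/-- `Y` is dense `(ℱ,𝒢)`-n-δ-chaotic for `f`: the `(ℱ,𝒢)`-δ-scrambled n-tuples in `Yⁿ`
form a dense subset of `Yⁿ`. -/
def DenseChaotic (f : X → X) (F G : Set (Set ℕ)) (n : ℕ) (δ : ℝ) (Y : Set X) : Prop :=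
  {x : Fin n → X | ∀ j, x j ∈ Y} ⊆
    closure {x : Fin n → X | (∀ j, x j ∈ Y) ∧ Scrambled f F G δ x}

/-- `S` is a residual subset of the subspace `T`: it contains a countable intersection of
dense open subsets of `T`. -/
def ResidualIn {α : Type*} [TopologicalSpace α] (T S : Set α) : Prop :=
  ∃ U : ℕ → Set α, (∀ i, IsOpen (U i)) ∧ (∀ i, T ⊆ closure (U i ∩ T)) ∧
    (⋂ i, U i) ∩ T ⊆ S

/-- `Y` is generic `(ℱ,𝒢)`-n-δ-chaotic for `f`: the `(ℱ,𝒢)`-δ-scrambled n-tuples in `Yⁿ`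
form a residual subset of `Yⁿ`. -/
def GenericChaotic (f : X → X) (F G : Set (Set ℕ)) (n : ℕ) (δ : ℝ) (Y : Set X) : Prop :=
  ResidualIn {x : Fin n → X | ∀ j, x j ∈ Y}
    {x : Fin n → X | (∀ j, x j ∈ Y) ∧ Scrambled f F G δ x}

/-- A Furstenberg family `F` is compatible with `(Z, g)`. -/
def CompatibleFamily {Z : Type*} [TopologicalSpace Z] (F : Set (Set ℕ)) (g : Z → Z) : Prop :=
  ∀ U : Set Z, IsOpen U → IsGδ {z | {i | g^[i] z ∈ U} ∈ F}

end Defs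

section Chains

variable {X : Type*} [MetricSpace X] {f : X → X} {C : Set X} {δ η : ℝ} {k l : ℕ} {x y z : X}

theorem ChainIn.mono {C' : Set X} (h : ChainIn f C δ k x y) (hδ : δ ≤ η) (hC : C ⊆ C') :
    ChainIn f C' η k x y := by
  obtain ⟨hk, c, h0, h1, hc, hd⟩ := h
  exact ⟨hk, c, h0, h1, fun i hi => hC (hc i hi), fun i hi => (hd i hi).trans hδ⟩

theorem ChainIn.trans (h : ChainIn f C δ k x y) (h' : ChainIn f C δ l y z) :
    ChainIn f C δ (k + l) x z := by
  obtain ⟨hk, c, h0, h1, hc, hd⟩ := h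
  obtain ⟨hl, c', h0', h1', hc', hd'⟩ := h'
  refine ⟨by omega, fun i => if i ≤ k then c i else c' (i - k), by simp [h0], ?_, ?_, ?_⟩
  · simp [h1', show l ≠ 0 by omega]
  · intro i hi
    dsimp only
    split_ifs with hik
    · exact hc i hik
    · exact hc' _ (by omega)
  · intro i hi
    dsimp only
    rcases lt_trichotomy i k with hik | rfl | hik
    · rw [if_pos hik.le, if_pos (by omega)]
      exact hd i hik
    · rw [if_pos le_rfl, if_neg (by omega), h1, ← h0', Nat.add_sub_cancel_left]
      exact hd' 0 hl
    · rw [if_neg (by omega), if_neg (by omega), Nat.sub_add_comm hik.le]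
      exact hd' _ (by omega)

theorem ChainIn.change_right (h : ChainIn f C δ k x y) (hz : z ∈ C) (hd : dist y z ≤ η)
    (hη : 0 ≤ η) : ChainIn f C (δ + η) k x z := by
  obtain ⟨hk, c, h0, h1, hc, hcd⟩ := h
  refine ⟨hk, fun i => if i = k then z else c i, ?_, by simp, ?_, ?_⟩
  · simp [show 0 ≠ k by omega, h0]
  · intro i hi
    dsimp only
    split_ifs with hik
    · exact hz
    · exact hc i hi
  · intro i hi
    dsimp only
    rw [if_neg hi.ne]
    have h2 := hcd i hi
    split_ifs with hik
    · rw [hik, h1] at h2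
      linarith [dist_triangle (f (c i)) y z]
    · linarith

theorem ChainIn.change_left (h : ChainIn f C δ k x y) (hz : z ∈ C)
    (hd : dist (f z) (f x) ≤ η) (hη : 0 ≤ η) : ChainIn f C (δ + η) k z y := by
  obtain ⟨hk, c, h0, h1, hc, hcd⟩ := h
  refine ⟨hk, fun i => if i = 0 then z else c i, by simp, ?_, ?_, ?_⟩
  · simp [show k ≠ 0 by omega, h1]
  · intro i hi
    dsimp only
    split_ifs with hik
    · exact hz
    · exact hc i hi
  · intro i hi
    dsimp only
    rw [if_neg i.succ_ne_zero]
    have h2 := hcd i hi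
    split_ifs with hik
    · rw [hik] at h2 ⊢
      rw [h0] at h2
      linarith [dist_triangle (f z) (f x) (c (0 + 1))]
    · linarith

theorem chainIn_split {c : ℕ → X} (hc : ∀ i ≤ k, c i ∈ C)
    (hd : ∀ i < k, dist (f (c i)) (c (i + 1)) ≤ δ) {i : ℕ} (hi0 : 0 < i) (hik : i < k) :
    ChainIn f C δ i (c 0) (c i) ∧ ChainIn f C δ (k - i) (c i) (c k) := by
  refine ⟨⟨hi0, c, rfl, rfl, fun j hj => hc j (by omega), fun j hj => hd j (by omega)⟩,
    ⟨by omega, fun j => c (i + j), rfl, ?_, fun j hj => hc _ (by omega),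
      fun j hj => hd (i + j) (by omega)⟩⟩
  dsimp only
  rw [Nat.add_sub_cancel' hik.le]

theorem chainIn_iterate (hC : MapsTo f C C) (hx : x ∈ C) (hδ : 0 ≤ δ) (hk : 1 ≤ k) :
    ChainIn f C δ k x (f^[k] x) :=
  ⟨hk, fun i => f^[i] x, rfl, rfl, fun i _ => hC.iterate i hx, fun i _ => by
    simpa [Function.iterate_succ_apply'] using hδ⟩

theorem ChainReach.trans (h : ChainReach f x y) (h' : ChainReach f y z) : ChainReach f x z := by
  intro δ hδ
  obtain ⟨k, hk⟩ := h δ hδ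
  obtain ⟨l, hl⟩ := h' δ hδ
  exact ⟨_, hk.trans hl⟩

theorem chainReach_of_forall_approx_right
    (h : ∀ η > 0, ∃ w k, dist w y ≤ η ∧ ChainIn f univ η k x w) : ChainReach f x y := by
  intro δ hδ
  obtain ⟨w, k, hw, hk⟩ := h (δ / 2) (by positivity)
  exact ⟨k, (hk.change_right (mem_univ y) hw (by positivity)).mono (by linarith) subset_rfl⟩

theorem chainReach_of_forall_approx_left (hf : Continuous f)
    (h : ∀ η > 0, ∃ w k, dist w x ≤ η ∧ ChainIn f univ η k w y) : ChainReach f x y := by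
  intro δ hδ
  obtain ⟨r, hr, hfr⟩ := Metric.continuous_iff.1 hf x (δ / 2) (by positivity)
  obtain ⟨w, k, hw, hk⟩ := h (min (δ / 2) (r / 2)) (by positivity)
  have h1 : dist (f x) (f w) ≤ δ / 2 := by
    rw [dist_comm]
    exact (hfr w (by linarith [min_le_right (δ / 2) (r / 2)])).le
  exact ⟨k, (hk.change_left (mem_univ x) h1 (by positivity)).mono
    (by linarith [min_le_left (δ / 2) (r / 2)]) subset_rfl⟩

theorem IsChainComponent.chainReach (hC : IsChainComponent f C) (hx : x ∈ C) (hy : y ∈ C) :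
    ChainReach f x y := by
  obtain ⟨a, -, rfl⟩ := hC
  exact hx.2.2.trans hy.2.1

theorem IsChainComponent.mem_of_chainReach (hC : IsChainComponent f C) (hx : x ∈ C) (hy : y ∈ C)
    (hxz : ChainReach f x z) (hzy : ChainReach f z y) : z ∈ C := by
  have hyx := hC.chainReach hy hx
  obtain ⟨a, -, rfl⟩ := hC
  exact ⟨(hzy.trans hyx).trans hxz, hx.2.1.trans hxz, hzy.trans hy.2.2⟩

theorem IsChainComponent.mapsTo (hC : IsChainComponent f C) (hf : Continuous f) :
    MapsTo f C C := by
  intro x hx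
  refine hC.mem_of_chainReach hx hx (fun δ hδ => ⟨1, ?_⟩) ?_
  · exact chainIn_iterate (mapsTo_univ f univ) (mem_univ x) hδ.le le_rfl
  · refine chainReach_of_forall_approx_left hf fun η hη => ?_
    obtain ⟨k, hk⟩ := hC.chainReach hx hx η hη
    obtain ⟨h2, c, h0, h1, hc, hd⟩ := hk.trans hk
    have hk1 := hk.1
    refine ⟨c 1, k + k - 1, ?_, ?_⟩
    · have := hd 0 (by omega)
      rwa [h0, dist_comm] at this
    · rw [← h1]
      exact (chainIn_split hc hd one_pos (by omega)).2

/-- Fine chains between points of a chain component stay close to that component. -/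
theorem IsChainComponent.exists_chain_near [CompactSpace X] (hC : IsChainComponent f C)
    (hf : Continuous f) (hx : x ∈ C) (hy : y ∈ C) {r : ℝ} (hr : 0 < r) :
    ∃ η > 0, ∀ w k l, ChainIn f univ η k x w → ChainIn f univ η l w y → ∃ v ∈ C, dist w v < r := by
  by_contra! h
  choose w k l hk hl hw using fun n : ℕ => h (1 / ((n : ℝ) + 1)) Nat.one_div_pos_of_nat
  obtain ⟨a, φ, hφ, ha⟩ := CompactSpace.tendsto_subseq w
  have key : ∀ η > 0, ∃ i, dist (w (φ i)) a ≤ η ∧ 1 / ((φ i : ℝ) + 1) ≤ η := by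
    intro η hη
    have h1 := (Metric.tendsto_nhds.1 ha) η hη
    have h2 := (tendsto_one_div_add_atTop_nhds_zero_nat (𝕜 := ℝ)).comp hφ.tendsto_atTop
    obtain ⟨i, hi, hi'⟩ := (h1.and (h2.eventually_le_const hη)).exists
    exact ⟨i, hi.le, hi'⟩
  have haC : a ∈ C := by
    refine hC.mem_of_chainReach hx hy ?_ ?_
    · refine chainReach_of_forall_approx_right fun η hη => ?_
      obtain ⟨i, hi, hi'⟩ := key η hη
      exact ⟨_, _, hi, (hk (φ i)).mono hi' subset_rfl⟩
    · refine chainReach_of_forall_approx_left hf fun η hη => ?_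
      obtain ⟨i, hi, hi'⟩ := key η hη
      exact ⟨_, _, hi, (hl (φ i)).mono hi' subset_rfl⟩
  obtain ⟨i, hi, -⟩ := key (r / 2) (by positivity)
  linarith [hw (φ i) a haC]

/-- A chain component is internally chain transitive. -/
theorem IsChainComponent.exists_chainIn [CompactSpace X] (hC : IsChainComponent f C)
    (hf : Continuous f) (hx : x ∈ C) (hy : y ∈ C) (hδ : 0 < δ) : ∃ k, ChainIn f C δ k x y := by
  obtain ⟨r₀, hr₀, hfr⟩ := Metric.uniformContinuous_iff.1
    (CompactSpace.uniformContinuous_of_continuous hf) (δ / 3) (by positivity)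
  have hr : 0 < min r₀ (δ / 3) := by positivity
  obtain ⟨η, hη, hnear⟩ := hC.exists_chain_near hf hx hy hr
  obtain ⟨k, hk, c, h0, h1, hc, hd⟩ := hC.chainReach hx hy (min η (δ / 3)) (by positivity)
  have near : ∀ i ≤ k, ∃ v ∈ C, dist (c i) v < min r₀ (δ / 3) ∧ (c i ∈ C → v = c i) := by
    intro i hi
    by_cases hci : c i ∈ C
    · exact ⟨c i, hci, by simpa using hr, fun _ => rfl⟩
    · have hi0 : i ≠ 0 := by
        rintro rfl
        exact hci (h0 ▸ hx)
      have hik : i ≠ k := by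
        rintro rfl
        exact hci (h1 ▸ hy)
      obtain ⟨hl, hr'⟩ := chainIn_split hc hd (Nat.pos_of_ne_zero hi0) (lt_of_le_of_ne hi hik)
      rw [h0] at hl
      rw [h1] at hr'
      obtain ⟨v, hv, hvd⟩ := hnear _ _ _ (hl.mono (min_le_left _ _) subset_rfl)
        (hr'.mono (min_le_left _ _) subset_rfl)
      exact ⟨v, hv, hvd, fun h => absurd h hci⟩
  have near' : ∀ i, ∃ v, i ≤ k → v ∈ C ∧ dist (c i) v < min r₀ (δ / 3) ∧ (c i ∈ C → v = c i) := by
    intro i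
    by_cases hi : i ≤ k
    · obtain ⟨v, hv⟩ := near i hi
      exact ⟨v, fun _ => hv⟩
    · exact ⟨x, fun h => absurd h hi⟩
  choose g hg using near'
  refine ⟨k, hk, g, ?_, ?_, fun i hi => (hg i hi).1, fun i hi => ?_⟩
  · rw [(hg 0 (Nat.zero_le k)).2.2 (h0 ▸ hx), h0]
  · rw [(hg k le_rfl).2.2 (h1 ▸ hy), h1]
  · have e1 := hfr ((hg i hi.le).2.1.trans_le (min_le_left _ _))
    have e2 := (hg (i + 1) hi).2.1.trans_le (min_le_right _ _)
    have e3 := (hd i hi).trans (min_le_right _ _)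
    rw [dist_comm] at e1
    linarith [dist_triangle4 (f (g i)) (f (c i)) (c (i + 1)) (g (i + 1))]

theorem setGcd_eq_natSetGcd {S : Set ℕ} (hk : k ∈ S) (hk0 : k ≠ 0) :
    setGcd S = Nat.setGcd S := by
  refine IsGreatest.csSup_eq ⟨fun _ => Nat.setGcd_dvd_of_mem, fun d hd => ?_⟩
  refine Nat.le_of_dvd (Nat.pos_of_ne_zero fun h0 => hk0 ?_) (Nat.dvd_setGcd_iff.2 hd)
  exact Nat.setGcd_eq_zero_iff.1 h0 hk

theorem setGcd_cycleLengths (htrans : ∀ a ∈ C, ∀ b ∈ C, ∃ k, ChainIn f C δ k a b)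
    (hx : x ∈ C) :
    setGcd (cycleLengths f C δ) = Nat.setGcd (cycleLengths f C δ) := by
  obtain ⟨k, hk⟩ := htrans x hx x hx
  exact setGcd_eq_natSetGcd ⟨x, hx, hk⟩ (by have := hk.1; omega)

theorem simCd_self (htrans : ∀ a ∈ C, ∀ b ∈ C, ∃ k, ChainIn f C δ k a b)
    (hx : x ∈ C) : SimCd f C δ x x := by
  obtain ⟨k, hk⟩ := htrans x hx x hx
  refine ⟨k, ?_, hk⟩
  rw [setGcd_cycleLengths htrans hx]
  exact Nat.setGcd_dvd_of_mem ⟨x, hx, hk⟩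

theorem eventually_chainIn_self (htrans : ∀ a ∈ C, ∀ b ∈ C, ∃ k, ChainIn f C δ k a b)
    (hx : x ∈ C) :
    ∀ᶠ k in atTop, Nat.setGcd (cycleLengths f C δ) ∣ k → ChainIn f C δ k x x := by
  set S : Set ℕ := {k | ChainIn f C δ k x x}
  have hS : Nat.setGcd S ∣ Nat.setGcd (cycleLengths f C δ) := by
    refine Nat.dvd_setGcd_iff.2 ?_
    rintro k ⟨y, hy, hk⟩
    obtain ⟨a, ha⟩ := htrans x hx y hy
    obtain ⟨b, hb⟩ := htrans y hy x hx
    have h1 : Nat.setGcd S ∣ a + b := Nat.setGcd_dvd_of_mem (ha.trans hb)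
    have h2 : Nat.setGcd S ∣ a + k + b := Nat.setGcd_dvd_of_mem ((ha.trans hk).trans hb)
    rw [add_right_comm] at h2
    exact (Nat.dvd_add_right h1).1 h2
  have hcl : ∀ k ∈ AddSubmonoid.closure S, k = 0 ∨ ChainIn f C δ k x x := by
    intro k hk
    induction hk using AddSubmonoid.closure_induction with
    | mem k hk => exact Or.inr hk
    | zero => exact Or.inl rfl
    | add a b _ _ ha hb =>
      rcases ha with rfl | ha
      · rwa [zero_add]
      · rcases hb with rfl | hb
        · exact Or.inr ha
        · exact Or.inr (ha.trans hb)
  obtain ⟨n, hn⟩ := Nat.exists_mem_closure_of_ge S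
  filter_upwards [eventually_ge_atTop n, eventually_ge_atTop 1] with k hk hk1 hdvd
  exact (hcl k (hn k hk (hS.trans hdvd))).resolve_left (by omega)

theorem eventually_chainIn (htrans : ∀ a ∈ C, ∀ b ∈ C, ∃ k, ChainIn f C δ k a b)
    (hy : y ∈ C) {a : ℕ} (ha : ChainIn f C δ a x y)
    (hdvd : Nat.setGcd (cycleLengths f C δ) ∣ a) :
    ∀ᶠ k in atTop, Nat.setGcd (cycleLengths f C δ) ∣ k → ChainIn f C δ k x y := by
  have h := (tendsto_sub_atTop_nat a).eventually (eventually_chainIn_self htrans hy)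
  filter_upwards [h, eventually_ge_atTop a] with k hk hak hk'
  have h2 := ha.trans (hk (Nat.dvd_sub hk' hdvd))
  rwa [Nat.add_sub_cancel' hak] at h2

/-- Under s-limit shadowing, a chain ending on the orbit of `p` at the matching time is followed
by an orbit asymptotic to that of `p`. -/
theorem exists_asymptotic_of_chainIn {ε : ℝ} {p : X}
    (hδ : 0 ≤ δ) (hsh : ∀ x : ℕ → X,
      (∀ i, dist (f (x i)) (x (i + 1)) ≤ δ) →
      Tendsto (fun i => dist (f (x i)) (x (i + 1))) atTop (𝓝 0) →
      ∃ z : X, (∀ i, dist (f^[i] z) (x i) ≤ ε) ∧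
        Tendsto (fun i => dist (f^[i] z) (x i)) atTop (𝓝 0))
    (h : ChainIn f univ δ k x (f^[k] p)) :
    ∃ z, dist z x ≤ ε ∧ Tendsto (fun i => dist (f^[i] z) (f^[i] p)) atTop (𝓝 0) := by
  obtain ⟨hk, c, h0, h1, -, hd⟩ := h
  set ξ : ℕ → X := fun i => if i < k then c i else f^[i] p with hξ
  have hge : ∀ i, k ≤ i → ξ i = f^[i] p := fun i hi => if_neg (by omega)
  have hle : ∀ i, i ≤ k → ξ i = c i := by
    intro i hi
    rcases hi.lt_or_eq with hi | rfl
    · exact if_pos hi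
    · rw [hge i le_rfl, h1]
  have hstep : ∀ i, k ≤ i → dist (f (ξ i)) (ξ (i + 1)) = 0 := by
    intro i hi
    rw [hge i hi, hge (i + 1) (by omega), Function.iterate_succ_apply', dist_self]
  obtain ⟨z, hz, hz'⟩ := hsh ξ (fun i => by
    rcases lt_or_ge i k with hi | hi
    · rw [hle i hi.le, hle (i + 1) hi]
      exact hd i hi
    · rw [hstep i hi]
      exact hδ) (tendsto_const_nhds.congr' (by
        filter_upwards [eventually_ge_atTop k] with i hi
        exact (hstep i hi).symm))
  refine ⟨z, ?_, hz'.congr' ?_⟩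
  · have := hz 0
    rwa [hle 0 (Nat.zero_le k), h0] at this
  · filter_upwards [eventually_ge_atTop k] with i hi
    rw [hge i hi]

theorem mem_vStable_of_asymptotic {D : Set X} {p : X} (hC : MapsTo f C C) (hpC : p ∈ C)
    (hpD : p ∈ D) (h : Tendsto (fun i => dist (f^[i] z) (f^[i] p)) atTop (𝓝 0)) :
    z ∈ vStable f C D := by
  refine ⟨squeeze_zero (fun _ => infDist_nonneg)
    (fun i => infDist_le_dist_of_mem (hC.iterate i hpC)) h, fun δ _ Dd _ hDd => ?_⟩
  exact squeeze_zero (fun _ => infDist_nonneg)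
    (fun i => infDist_le_dist_of_mem (mem_image_of_mem _ (hDd hpD))) h

/-- Finitely many points of `V^s(D)` are approximated by points with a common asymptotic orbit
in `D`. -/
theorem exists_common_asymptotic [CompactSpace X] (hf : Continuous f) (hsls : SLimitShadowing f)
    (hC : IsChainComponent f C) {D : Set X} {p : X} (hp : p ∈ C)
    (hD : D = {y ∈ C | SimC f C p y}) {ι : Type*} [Finite ι] {x : ι → X}
    (hx : ∀ j, x j ∈ vStable f C D) {ε : ℝ} (hε : 0 < ε) :
    ∃ y : ι → X, ∀ j, dist (y j) (x j) ≤ ε ∧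
      Tendsto (fun i => dist (f^[i] (y j)) (f^[i] p)) atTop (𝓝 0) := by
  obtain ⟨δ₀, hδ₀, hsh⟩ := hsls ε hε
  obtain ⟨δ, hδ, hδδ⟩ : ∃ δ > 0, δ + δ = δ₀ := ⟨δ₀ / 2, by positivity, by ring⟩
  have hmaps := hC.mapsTo hf
  have htrans : ∀ a ∈ C, ∀ b ∈ C, ∃ k, ChainIn f C δ k a b :=
    fun a ha b hb => hC.exists_chainIn hf ha hb hδ
  obtain ⟨m, hm⟩ : ∃ m, m = Nat.setGcd (cycleLengths f C δ) := ⟨_, rfl⟩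
  have hcyc : ∀ a ∈ C, ∀ k, ChainIn f C δ k a a → m ∣ k :=
    fun a ha k hk => hm ▸ Nat.setGcd_dvd_of_mem ⟨a, ha, hk⟩
  have hm0 : 0 < m := by
    obtain ⟨k, hk⟩ := htrans p hp p hp
    exact Nat.pos_of_dvd_of_pos (hcyc p hp k hk) hk.1
  have hpδ : {y ∈ C | SimCd f C δ p y} ∈ DClassesd f C δ := ⟨p, hp, rfl⟩
  have hDδ : D ⊆ {y ∈ C | SimCd f C δ p y} := by
    rw [hD]
    exact fun y hy => ⟨hy.1, hy.2 δ hδ⟩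
  have hpp : p ∈ {y ∈ C | SimCd f C δ p y} := ⟨hp, simCd_self htrans hp⟩
  have hN : ∀ j, ∀ᶠ N in atTop, ∃ q ∈ {y ∈ C | SimCd f C δ p y},
      dist (f^[N] (x j)) (f^[N] q) < δ := by
    intro j
    filter_upwards [((hx j).2 δ hδ _ hpδ hDδ).eventually_lt_const hδ] with N hN
    rw [infDist_lt_iff ⟨_, mem_image_of_mem _ hpp⟩] at hN
    obtain ⟨_, ⟨q, hq, rfl⟩, hqd⟩ := hN
    exact ⟨q, hq, hqd⟩
  obtain ⟨N, hN, hN1⟩ := ((eventually_all.2 hN).and (eventually_ge_atTop 1)).exists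
  choose q hq hqd using hN
  obtain ⟨a, φ, hφ, ha⟩ := CompactSpace.tendsto_subseq fun k => f^[N + k * m] p
  obtain ⟨i₀, hi₀⟩ := eventually_atTop.1 (Metric.tendsto_nhds.1 ha (δ / 2) (by positivity))
  set t := f^[N + φ i₀ * m] p with ht
  have htC : t ∈ C := hmaps.iterate _ hp
  have hev : ∀ j, ∀ᶠ k in atTop, m ∣ k → ChainIn f C δ k (f^[N] (q j)) t := by
    intro j
    obtain ⟨hqC, s, hs, hsc⟩ := hq j
    rw [setGcd_cycleLengths htrans hp, ← hm] at hs
    have hqN : f^[N] (q j) ∈ C := hmaps.iterate _ hqC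
    obtain ⟨l, hl⟩ := htrans _ hqN t htC
    obtain ⟨b, hb⟩ := htrans t htC p hp
    have h1 := hcyc p hp _ (((hsc.trans (chainIn_iterate hmaps hqC hδ.le hN1)).trans hl).trans hb)
    have h2 := hcyc p hp _
      ((chainIn_iterate hmaps hp hδ.le (show 1 ≤ N + φ i₀ * m by omega)).trans hb)
    have hml : m ∣ l := by
      have h3 : m ∣ N + b := by
        rw [add_right_comm] at h2
        exact (Nat.dvd_add_left (Dvd.intro_left _ rfl)).1 h2
      have h4 : s + N + l + b = (s + (N + b)) + l := by ring
      rw [h4] at h1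
      exact (Nat.dvd_add_right (hs.add h3)).1 h1
    subst hm
    exact eventually_chainIn htrans htC hl hml
  have hlen : Tendsto (fun i => φ i * m) atTop atTop :=
    hφ.tendsto_atTop.atTop_mul_const' hm0
  obtain ⟨i, hi, hii⟩ :=
    ((hlen.eventually (eventually_all.2 hev)).and (eventually_ge_atTop i₀)).exists
  have hclose : dist t (f^[N + φ i * m] p) ≤ δ := by
    have e1 := hi₀ i hii
    have e2 := hi₀ i₀ le_rfl
    simp only [Function.comp_apply, ← ht] at e1 e2
    linarith [dist_triangle_right t (f^[N + φ i * m] p) a]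
  have hfin : ∀ j, ∃ z, dist z (x j) ≤ ε ∧
      Tendsto (fun i => dist (f^[i] z) (f^[i] p)) atTop (𝓝 0) := by
    intro j
    refine exists_asymptotic_of_chainIn (k := N + φ i * m) hδ₀.le hsh ?_
    have c1 : ChainIn f univ (0 + δ) N (x j) (f^[N] (q j)) :=
      (chainIn_iterate (mapsTo_univ f univ) (mem_univ _) le_rfl hN1).change_right (mem_univ _)
        (hqd j).le hδ.le
    have c2 := (hi j (Dvd.intro_left _ rfl)).change_right (hmaps.iterate _ hp) hclose hδ.le
    exact (c1.mono (by linarith) subset_rfl).trans (c2.mono hδδ.le (subset_univ C))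
  choose y hy using hfin
  exact ⟨y, hy⟩

theorem tset_mem_of_asymptotic {G : Set (Set ℕ)} (hG : FurstenbergFamily G)
    (hGfull : FullFamily G) {n : ℕ} {x : Fin n → X} {p : X}
    (hx : ∀ j, Tendsto (fun i => dist (f^[i] (x j)) (f^[i] p)) atTop (𝓝 0)) {ε : ℝ}
    (hε : 0 < ε) : Tset f x ε ∈ G := by
  obtain ⟨A, hA⟩ := hG.2.1
  have hev : ∀ᶠ i in atTop, ∀ j, dist (f^[i] (x j)) (f^[i] p) < ε / 2 :=
    eventually_all.2 fun j => (hx j).eventually_lt_const (by positivity)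
  obtain ⟨N, hN⟩ := eventually_atTop.1 hev
  refine hG.1 _ _ (hGfull A hA N) fun i hi j k _ => ?_
  linarith [hN i hi.2 j, hN i hi.2 k, dist_triangle_right (f^[i] (x j)) (f^[i] (x k)) (f^[i] p)]

end Chains

/-- Theorem 1.1: the set
`B = ⋂_{ε>0} {(x₁,…,xₙ) ∈ [V^s(D)]ⁿ : T_f(x₁,…,xₙ;ε) ∈ 𝒢}` is dense in `[V^s(D)]ⁿ`. -/
theorem tSet_family_dense_in_vStable_pow
    {X : Type*} [MetricSpace X] [CompactSpace X]
    (f : X → X) (hf : Continuous f) (hsls : SLimitShadowing f)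
    (C : Set X) (hC : IsChainComponent f C) (D : Set X) (hD : D ∈ DClasses f C)
    (G : Set (Set ℕ)) (hG : FurstenbergFamily G) (hGfull : FullFamily G)
    (n : ℕ) (hn : 2 ≤ n) :
    {x : Fin n → X | ∀ j, x j ∈ vStable f C D} ⊆
      closure {x : Fin n → X | (∀ j, x j ∈ vStable f C D) ∧ ∀ ε > 0, Tset f x ε ∈ G} := by
  intro x hx
  obtain ⟨p, hp, hDp⟩ := hD
  have hpD : p ∈ D := by
    rw [hDp]
    exact ⟨hp, fun δ hδ => simCd_self (fun a ha b hb => hC.exists_chainIn hf ha hb hδ) hp⟩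
  rw [Metric.mem_closure_iff]
  intro ε hε
  obtain ⟨y, hy⟩ := exists_common_asymptotic hf hsls hC hp hDp hx (half_pos hε)
  refine ⟨y, ⟨fun j => mem_vStable_of_asymptotic (hC.mapsTo hf) hp hpD (hy j).2, fun r hr =>
    tset_mem_of_asymptotic hG hGfull (fun j => (hy j).2) hr⟩, ?_⟩
  rw [dist_comm]
  exact (dist_pi_lt_iff hε).2 fun j => (hy j).1.trans_lt (half_lt_self hε)
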